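/- With the sequence b^(i) defined as above (b^(I) = b, and b^(i) = (b^(i+1) - (K + z^(i+1)))/2 when b^(i+1) > K), for every i with b^(i+1) > K at all intermediate steps it holds that b^(i) = ⌊ b / 2^(I-i) - K · ∑_{ℓ=i}^{I-1} 1/2^(I-ℓ) ⌋. -/

import Mathlib

open Finset

lemma sum_aux (n i : ℕ) :
    ∑ ℓ ∈ Finset.Ico i (i + n), (1 : ℚ) / 2 ^ (i + n - ℓ) = 1 - 1 / 2 ^ n := by
  induction n generalizing i with
  | zero => simp
  | succ n ih =>
    rw [Finset.sum_eq_sum_Ico_succ_bot (by omega)]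
    have h := ih (i + 1)
    have e : i + 1 + n = i + (n + 1) := by ring
    rw [e] at h
    rw [h, Nat.add_sub_cancel_left, pow_succ]
    field_simp
    ring

lemma inv_aux (K b : ℤ) (I : ℕ) (f : ℕ → ℤ) (hfI : f I = b)
    (hrec : ∀ j < I, K < f (j+1) →
      2 * f j = f (j+1) - (K + (if f (j+1) % 2 = K % 2 then 0 else 1)))
    (n i : ℕ) (hi : i + n = I) (hbig : ∀ j, i < j → j ≤ I → K < f j) :
    f i * 2 ^ n ≤ b - K * (2 ^ n - 1) ∧ b - K * (2 ^ n - 1) < (f i + 1) * 2 ^ n := by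
  induction n generalizing i with
  | zero =>
    have : i = I := by omega
    subst this
    simp [hfI]
  | succ n ih =>
    obtain ⟨h1, h2⟩ := ih (i + 1) (by omega) (fun j hj hj' => hbig j (by omega) hj')
    have h := hrec i (by omega) (hbig (i + 1) (by omega) (by omega))
    have hP : (0 : ℤ) < 2 ^ n := by positivity
    have l1 : 2 * f i ≤ f (i + 1) - K := by split_ifs at h <;> omega
    have l2 : f (i + 1) - K ≤ 2 * f i + 1 := by split_ifs at h <;> omega
    rw [pow_succ]
    generalize (2 : ℤ) ^ n = P at *
    constructor
    · nlinarith [mul_le_mul_of_nonneg_right l1 hP.le]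
    · nlinarith [mul_le_mul_of_nonneg_right l2 hP.le]

/-- Closed form for the iterated parity-corrected halving when all intermediate
values exceed `K`. -/
theorem stmt2 (K : ℤ) (hK : 0 ≤ K) (b : ℤ) (hb : 0 ≤ b) (I : ℕ) (f : ℕ → ℤ)
    (hfI : f I = b)
    (hrec : ∀ j < I, K < f (j+1) →
      2 * f j = f (j+1) - (K + (if f (j+1) % 2 = K % 2 then 0 else 1)))
    (i : ℕ) (hi : i ≤ I)
    (hbig : ∀ j, i < j → j ≤ I → K < f j) :
    f i = ⌊(b : ℚ) / 2 ^ (I - i) - (K : ℚ) * ∑ ℓ ∈ Finset.Ico i I, (1 : ℚ) / 2 ^ (I - ℓ)⌋ := by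
  obtain ⟨n, rfl⟩ := Nat.exists_eq_add_of_le hi
  obtain ⟨h1, h2⟩ := inv_aux K b (i + n) f hfI hrec n i rfl hbig
  rw [sum_aux, Nat.add_sub_cancel_left]
  have hP : (0 : ℚ) < 2 ^ n := by positivity
  have e : (b : ℚ) / 2 ^ n - K * (1 - 1 / 2 ^ n) = (b - K * (2 ^ n - 1)) / 2 ^ n := by
    field_simp
  rw [e]
  symm
  rw [Int.floor_eq_iff, le_div_iff₀ hP, div_lt_iff₀ hP]
  exact ⟨by exact_mod_cast h1, by exact_mod_cast h2⟩
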